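/- arXiv:2211.00942 — 5 statements merged into one kernel-verified Lean document; each statement's English description precedes it below -/
import Mathlib

section
/- Let K ≥ 1, l ≥ 1, m ≥ 1, let S ⊆ ℝ^l be a compact set (the state space) and let A ⊆ ℝ^m be a compact set (the action space), let t₀ ∈ ℝ and τ > 0. Suppose: (i) f : ℝ^l → ℝ^K × ℝ^K is K_f-Lipschitz (the encoder); (ii) g : ℝ^K × ℝ^K → ℝ^l is K_g-Lipschitz (the decoder); (iii) h : (ℝ^K × ℝ^K) × ℝ^m × ℝ → ℝ^K × ℝ^K is continuously differentiable (C¹); (iv) there is a convex compact set D ⊆ ℝ^K × ℝ^K such that for each s ∈ S and a ∈ A there is a differentiable curve u_{s,a} : [t₀, t₀ + τ] → D with u_{s,a}(t₀) = f(s) and u_{s,a}'(t) = h(u_{s,a}(t), a, t) for all t ∈ [t₀, t₀ + τ]. Let L be the supremum over (u, a, t) ∈ D × A × [t₀, t₀ + τ] of the operator norm of the partial derivative of h with respect to its first (latent-state) argument; L is finite since h is C¹ and D × A × [t₀, t₀ + τ] is compact. Define the NODA transition map by s_next(s, a) = g(u_{s,a}(t₀ + τ)). Then for all a ∈ A and all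 s, s' ∈ S, ‖s_next(s, a) − s_next(s', a)‖ ≤ K_g · exp(L·τ) · K_f · ‖s − s'‖. In particular, sup over a ∈ A and over distinct s, s' ∈ S of ‖s_next(s, a) − s_next(s', a)‖ / ‖s − s'‖ is finite, i.e., NODA is a Lipschitz model. -/
open Set

/-- A Lipschitz bound on a nontrivial normed space has a nonnegative constant. -/
theorem nonneg_of_forall_norm_sub_le {E F : Type*} [NormedAddCommGroup E] [Nontrivial E]
    [SeminormedAddCommGroup F] {g : E → F} {C : ℝ}
    (hg : ∀ x y, ‖g x - g y‖ ≤ C * ‖x - y‖) : 0 ≤ C := by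
  obtain ⟨x, y, hxy⟩ := exists_pair_ne E
  exact nonneg_of_mul_nonneg_left ((norm_nonneg _).trans (hg x y))
    (norm_pos_iff.2 (sub_ne_zero.2 hxy))

section

variable {E P F : Type*} [NormedAddCommGroup E] [NormedSpace ℝ E]
  [NormedAddCommGroup P] [NormedSpace ℝ P] [NormedAddCommGroup F] [NormedSpace ℝ F]

/-- The partial derivative of a `C¹` map in its first argument is jointly continuous. -/
theorem ContDiff.continuous_fderiv_left {h : E × P → F} (hh : ContDiff ℝ 1 h) :
    Continuous fun p : E × P => fderiv ℝ (fun v => h (v, p.2)) p.1 := by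
  have key (p : E × P) : fderiv ℝ (fun v => h (v, p.2)) p.1 =
      (fderiv ℝ h p).comp (ContinuousLinearMap.inl ℝ E P) :=
    ((hh.differentiable one_ne_zero p).hasFDerivAt.comp p.1
      (hasFDerivAt_prodMk_left p.1 p.2)).fderiv
  simp only [key]
  exact (hh.continuous_fderiv one_ne_zero).clm_comp continuous_const

/-- Two solutions on `[a, b]` of an ODE whose right-hand side has derivative bounded by `L` on a
convex set containing both solutions diverge at most exponentially with rate `L`. -/
theorem norm_sub_le_exp_of_norm_fderiv_le {v : ℝ → E → E} {D : Set E} (hD : Convex ℝ D)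
    {a b L : ℝ} (hab : a ≤ b) (hL : 0 ≤ L) (hv : ∀ t ∈ Icc a b, Differentiable ℝ (v t))
    (bound : ∀ t ∈ Icc a b, ∀ x ∈ D, ‖fderiv ℝ (v t) x‖ ≤ L) {y z : ℝ → E}
    (hy : ∀ t ∈ Icc a b, HasDerivWithinAt y (v t (y t)) (Icc a b) t)
    (hyD : ∀ t ∈ Icc a b, y t ∈ D)
    (hz : ∀ t ∈ Icc a b, HasDerivWithinAt z (v t (z t)) (Icc a b) t)
    (hzD : ∀ t ∈ Icc a b, z t ∈ D) :
    ‖y b - z b‖ ≤ ‖y a - z a‖ * Real.exp (L * (b - a)) := by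
  lift L to NNReal using hL
  have right {w : ℝ → E} (hw : ∀ t ∈ Icc a b, HasDerivWithinAt w (v t (w t)) (Icc a b) t) :
      ∀ t ∈ Ico a b, HasDerivWithinAt w (v t (w t)) (Ici t) t := fun t ht =>
    (hw t (Ico_subset_Icc_self ht)).mono_of_mem_nhdsWithin (Icc_mem_nhdsGE_of_mem ht)
  simpa only [dist_eq_norm] using dist_le_of_trajectories_ODE_of_mem (s := fun _ => D)
    (fun t ht => hD.lipschitzOnWith_of_nnnorm_fderiv_le
      (fun x _ => hv t (Ico_subset_Icc_self ht) x)
      fun x hx => bound t (Ico_subset_Icc_self ht) x hx)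
    (fun t ht => (hy t ht).continuousWithinAt) (right hy)
    (fun t ht => hyD t (Ico_subset_Icc_self ht))
    (fun t ht => (hz t ht).continuousWithinAt) (right hz)
    (fun t ht => hzD t (Ico_subset_Icc_self ht)) le_rfl b (right_mem_Icc.2 hab)

end

/-- **Theorem 2 (Lipschitz NODA), full conclusion.**
With a `K_f`-Lipschitz encoder `f`, a `K_g`-Lipschitz decoder `g`, a `C¹` neural-ODE
right-hand side `h`, latent trajectories `u_{s,a}` in a convex compact set `D` solving
`u' = h (u, a, t)` on `[t₀, t₀ + τ]` with initial value `f s`, and `L` the supremum of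
the operator norms of the latent-state partial derivative of `h` over
`D × A × [t₀, t₀ + τ]`, the NODA transition map `s_next (s, a) = g (u_{s,a} (t₀ + τ))`
satisfies `‖s_next (s, a) − s_next (s', a)‖ ≤ K_g * exp (L * τ) * K_f * ‖s − s'‖`;
i.e. NODA is a Lipschitz model. -/
theorem noda_is_lipschitz_model
    (K l m : ℕ) (hK : 1 ≤ K) (hl : 1 ≤ l) (hm : 1 ≤ m)
    (S : Set (EuclideanSpace ℝ (Fin l))) (hS : IsCompact S)
    (A : Set (EuclideanSpace ℝ (Fin m))) (hA : IsCompact A)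
    (t₀ τ : ℝ) (hτ : 0 < τ)
    (f : EuclideanSpace ℝ (Fin l) → EuclideanSpace ℝ (Fin K) × EuclideanSpace ℝ (Fin K))
    (Kf : ℝ) (hf : ∀ x y, ‖f x - f y‖ ≤ Kf * ‖x - y‖)
    (g : EuclideanSpace ℝ (Fin K) × EuclideanSpace ℝ (Fin K) → EuclideanSpace ℝ (Fin l))
    (Kg : ℝ) (hg : ∀ x y, ‖g x - g y‖ ≤ Kg * ‖x - y‖)
    (h : (EuclideanSpace ℝ (Fin K) × EuclideanSpace ℝ (Fin K)) ×
      EuclideanSpace ℝ (Fin m) × ℝ → EuclideanSpace ℝ (Fin K) × EuclideanSpace ℝ (Fin K))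
    (hh : ContDiff ℝ 1 h)
    (D : Set (EuclideanSpace ℝ (Fin K) × EuclideanSpace ℝ (Fin K)))
    (hDconv : Convex ℝ D) (hDcomp : IsCompact D)
    (ucurve : EuclideanSpace ℝ (Fin l) → EuclideanSpace ℝ (Fin m) → ℝ →
      EuclideanSpace ℝ (Fin K) × EuclideanSpace ℝ (Fin K))
    (hmem : ∀ s ∈ S, ∀ a ∈ A, ∀ t ∈ Icc t₀ (t₀ + τ), ucurve s a t ∈ D)
    (hinit : ∀ s ∈ S, ∀ a ∈ A, ucurve s a t₀ = f s)
    (hode : ∀ s ∈ S, ∀ a ∈ A, ∀ t ∈ Icc t₀ (t₀ + τ),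
      HasDerivWithinAt (ucurve s a) (h (ucurve s a t, a, t)) (Icc t₀ (t₀ + τ)) t)
    (L : ℝ)
    (hL : L = sSup {x : ℝ | ∃ u ∈ D, ∃ a ∈ A, ∃ t ∈ Icc t₀ (t₀ + τ),
      x = ‖fderiv ℝ (fun v => h (v, a, t)) u‖})
    (snext : EuclideanSpace ℝ (Fin l) → EuclideanSpace ℝ (Fin m) →
      EuclideanSpace ℝ (Fin l))
    (hsnext : ∀ s a, snext s a = g (ucurve s a (t₀ + τ))) :
    ∀ a ∈ A, ∀ s ∈ S, ∀ s' ∈ S,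
      ‖snext s a - snext s' a‖ ≤ Kg * Real.exp (L * τ) * Kf * ‖s - s'‖ := by
  intro a ha s hs s' hs'
  have : NeZero K := ⟨by omega⟩
  have hKg : 0 ≤ Kg := nonneg_of_forall_norm_sub_le hg
  have hbdd : BddAbove {x : ℝ | ∃ u ∈ D, ∃ a ∈ A, ∃ t ∈ Icc t₀ (t₀ + τ),
      x = ‖fderiv ℝ (fun v => h (v, a, t)) u‖} := by
    refine ((hDcomp.prod (hA.prod (isCompact_Icc (a := t₀) (b := t₀ + τ)))).bddAbove_image
      hh.continuous_fderiv_left.norm.continuousOn).mono ?_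
    rintro _ ⟨u, hu, a, ha, t, ht, rfl⟩
    exact ⟨(u, a, t), ⟨hu, ha, ht⟩, rfl⟩
  have hL0 : 0 ≤ L := by
    rw [hL]
    refine Real.sSup_nonneg ?_
    rintro _ ⟨u, -, a, -, t, -, rfl⟩
    exact norm_nonneg _
  have hflow := norm_sub_le_exp_of_norm_fderiv_le (v := fun t x => h (x, a, t)) hDconv
    (le_add_of_nonneg_right hτ.le) hL0
    (fun t _ => (hh.differentiable one_ne_zero).comp (by fun_prop))
    (fun t ht x hx => hL ▸ le_csSup hbdd ⟨x, hx, a, ha, t, ht, rfl⟩)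
    (hode s hs a ha) (hmem s hs a ha) (hode s' hs' a ha) (hmem s' hs' a ha)
  rw [hinit s hs a ha, hinit s' hs' a ha, add_sub_cancel_left] at hflow
  rw [hsnext, hsnext]
  calc _ ≤ Kg * ‖ucurve s a (t₀ + τ) - ucurve s' a (t₀ + τ)‖ := hg _ _
    _ ≤ Kg * (Kf * ‖s - s'‖ * Real.exp (L * τ)) := by
      gcongr
      exact hflow.trans (by gcongr; exact hf s s')
    _ = Kg * Real.exp (L * τ) * Kf * ‖s - s'‖ := by ring
end

section
/- Let (S, d) be a metric space, A a nonempty set, and let T, T̂ : S × A → S be two deterministic transition functions such that for every a ∈ A the map s ↦ T(s, a) is K₁-Lipschitz and the map s ↦ T̂(s, a) is K₂-Lipschitz. Let K̄ = min(K₁, K₂), and let Δ ≥ 0 satisfy d(T(s, a), T̂(s, a)) ≤ Δ for all s ∈ S and a ∈ A. Then for every sequence of actions a₀, a₁, a₂, … ∈ A, every initial state s₀ ∈ S, and every n ≥ 1, the n-step trajectories defined by s_{k+1} = T(s_k, a_k) and ŝ₀ = s₀, ŝ_{k+1} = T̂(ŝ_k, a_k) satisfy the uniform multi-step transition error bound d(s_n,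 ŝ_n) ≤ Δ · Σ_{i=0}^{n−1} K̄^i. -/
open scoped NNReal

/-- A discrete Grönwall inequality: iterating `u (n + 1) ≤ K * u n + Δ` from `u 0 ≤ 0`. -/
theorem le_mul_geom_sum_of_le_mul_add {u : ℕ → ℝ} {K Δ : ℝ} (hK : 0 ≤ K) (h0 : u 0 ≤ 0)
    (hu : ∀ n, u (n + 1) ≤ K * u n + Δ) (n : ℕ) :
    u n ≤ Δ * ∑ i ∈ Finset.range n, K ^ i := by
  induction n with
  | zero => simpa using h0
  | succ n ih =>
    calc u (n + 1) ≤ K * u n + Δ := hu n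
      _ ≤ K * (Δ * ∑ i ∈ Finset.range n, K ^ i) + Δ := by gcongr
      _ = Δ * ∑ i ∈ Finset.range (n + 1), K ^ i := by
        rw [geom_sum_succ]
        ring

/-- Images under two uniformly close maps, the first of which is Lipschitz. -/
theorem LipschitzWith.dist_le_mul_add_of_dist_le {X Y : Type*} [PseudoMetricSpace X]
    [PseudoMetricSpace Y] {K : ℝ≥0} {f g : X → Y} {Δ : ℝ} (hf : LipschitzWith K f)
    (hfg : ∀ x, dist (f x) (g x) ≤ Δ) (x y : X) :
    dist (f x) (g y) ≤ K * dist x y + Δ :=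
  (dist_triangle _ (f y) _).trans (add_le_add (hf.dist_le_mul x y) (hfg y))

/-- **Theorem 3 (Transition Error Bounds), deterministic case.**
If for every action `a` the maps `s ↦ T s a` and `s ↦ T̂ s a` are `K₁`- and
`K₂`-Lipschitz respectively, the one-step outputs differ by at most `Δ`, and `s`, `ŝ`
are the trajectories generated from the same initial state `s₀` under the same action
sequence by `T` and `T̂` respectively, then for every `n ≥ 1`,
`d (s n, ŝ n) ≤ Δ * Σ_{i=0}^{n−1} (min K₁ K₂)^i`, uniformly over all action
sequences and initial states. -/
theorem transition_error_bounds
    {S : Type*} [MetricSpace S] {A : Type*} [Nonempty A]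
    (T That : S → A → S) (K₁ K₂ : ℝ≥0)
    (hT : ∀ a : A, LipschitzWith K₁ (fun s => T s a))
    (hThat : ∀ a : A, LipschitzWith K₂ (fun s => That s a))
    (Δ : ℝ) (hΔ0 : 0 ≤ Δ)
    (hΔ : ∀ (s : S) (a : A), dist (T s a) (That s a) ≤ Δ)
    (acts : ℕ → A) (s₀ : S)
    (straj shat : ℕ → S)
    (hs0 : straj 0 = s₀) (hshat0 : shat 0 = s₀)
    (hstep : ∀ n, straj (n + 1) = T (straj n) (acts n))
    (hhatstep : ∀ n, shat (n + 1) = That (shat n) (acts n)) :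
    ∀ n : ℕ, 1 ≤ n →
      dist (straj n) (shat n) ≤ Δ * ∑ i ∈ Finset.range n, (↑(min K₁ K₂) : ℝ) ^ i := by
  intro n _
  refine le_mul_geom_sum_of_le_mul_add (u := fun n => dist (straj n) (shat n))
    (min K₁ K₂).coe_nonneg (by simp [hs0, hshat0]) (fun k => ?_) n
  simp only [hstep, hhatstep]
  rcases min_choice K₁ K₂ with h | h <;> rw [h]
  · exact (hT (acts k)).dist_le_mul_add_of_dist_le (fun s => hΔ s (acts k)) _ _
  · rw [dist_comm, dist_comm (straj k)]
    exact (hThat (acts k)).dist_le_mul_add_of_dist_le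
      (fun s => (dist_comm _ _).trans_le (hΔ s (acts k))) _ _
end

section
/- For every K ≥ 0 and Δ ≥ 0, the maps f, g : ℝ → ℝ defined by f(s) = K·s and g(s) = K·s + Δ satisfy: (i) both f and g are K-Lipschitz; (ii) |f(s) − g(s)| = Δ for every s ∈ ℝ; and (iii) for every n ≥ 0 and every s ∈ ℝ, the n-fold iterates satisfy |f^[n](s) − g^[n](s)| = Δ · Σ_{i=0}^{n−1} K^i. Hence the multi-step transition error bound d(s_n, ŝ_n) ≤ Δ · Σ_{i=0}^{n−1} K̄^i is attained with equality by linear deterministic transitions. -/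
/-- Iterates of `s ↦ K * s` and `s ↦ K * s + Δ` from a common starting point drift apart by `Δ`
times a geometric sum, whatever that point is. -/
theorem iterate_affine_sub_iterate_linear {K Δ : ℝ} {f g : ℝ → ℝ}
    (hf : ∀ s, f s = K * s) (hg : ∀ s, g s = K * s + Δ) (n : ℕ) (s : ℝ) :
    g^[n] s - f^[n] s = Δ * ∑ i ∈ Finset.range n, K ^ i := by
  induction n with
  | zero => simp
  | succ n ih =>
    rw [Function.iterate_succ_apply', Function.iterate_succ_apply', hf, hg, geom_sum_succ]
    linear_combination K * ih

/-- **Tightness of Theorem 3 (Transition Error Bounds) for linear deterministic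
transitions.** For `K ≥ 0` and `Δ ≥ 0`, the maps `f s = K * s` and `g s = K * s + Δ`
are both `K`-Lipschitz, their outputs differ by exactly `Δ` everywhere, and their
`n`-fold iterates satisfy `|f^[n] s − g^[n] s| = Δ * Σ_{i=0}^{n−1} K^i`; hence the
multi-step transition error bound is attained with equality. -/
theorem transition_error_bound_tight_for_linear
    (K Δ : ℝ) (hK : 0 ≤ K) (hΔ : 0 ≤ Δ)
    (f g : ℝ → ℝ) (hf : ∀ s, f s = K * s) (hg : ∀ s, g s = K * s + Δ) :
    (∀ x y : ℝ, |f x - f y| ≤ K * |x - y|) ∧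
    (∀ x y : ℝ, |g x - g y| ≤ K * |x - y|) ∧
    (∀ s : ℝ, |f s - g s| = Δ) ∧
    (∀ (n : ℕ) (s : ℝ), |f^[n] s - g^[n] s| = Δ * ∑ i ∈ Finset.range n, K ^ i) := by
  have hlin (x y : ℝ) : |K * x - K * y| ≤ K * |x - y| := by
    rw [← mul_sub, abs_mul, abs_of_nonneg hK]
  refine ⟨fun x y => ?_, fun x y => ?_, fun s => ?_, fun n s => ?_⟩
  · simpa only [hf] using hlin x y
  · simpa only [hg, add_sub_add_right_eq_sub] using hlin x y
  · rw [hf, hg, sub_add_cancel_left, abs_neg, abs_of_nonneg hΔ]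
  · rw [abs_sub_comm, iterate_affine_sub_iterate_linear hf hg, abs_of_nonneg (by positivity)]
end

section
/- Let (S, d) be a metric space, A a nonempty set, and let T, T̂ : S × A → S be two deterministic transition functions such that for every a ∈ A the map s ↦ T(s, a) is K₁-Lipschitz and the map s ↦ T̂(s, a) is K₂-Lipschitz. Let K̄ = min(K₁, K₂) with K̄ ≥ 0, and let Δ ≥ 0 satisfy d(T(s, a), T̂(s, a)) ≤ Δ for all s ∈ S and a ∈ A. Let γ ∈ [0, 1) with γ·K̄ < 1. Then for every sequence of actions a₀, a₁, … ∈ A and every initial state s₀ ∈ S, the trajectories s_{k+1} = T(s_k, a_k) and ŝ₀ = s₀, ŝ_{k+1} = T̂(ŝ_k, a_k) satisfy Σ_{n=0}^∞ γ^n · d(s_n, ŝ_n) ≤ γ·Δ / ((1 − γ)(1 − γ·K̄)); in particular this series converges. -/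
open scoped NNReal

/-- Images of two points under two `Δ`-close Lipschitz maps: the smaller of the two Lipschitz
constants controls the distance. -/
theorem dist_le_add_min_mul_dist {X Y : Type*} [PseudoMetricSpace X] [PseudoMetricSpace Y]
    {f g : X → Y} {K₁ K₂ : ℝ≥0} {Δ : ℝ} (hf : LipschitzWith K₁ f) (hg : LipschitzWith K₂ g)
    (hfg : ∀ x, dist (f x) (g x) ≤ Δ) (x y : X) :
    dist (f x) (g y) ≤ Δ + (↑(min K₁ K₂) : ℝ) * dist x y := by
  rcases min_choice K₁ K₂ with h | h <;> rw [h]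
  · linarith [dist_triangle (f x) (f y) (g y), hf.dist_le_mul x y, hfg y]
  · linarith [dist_triangle (f x) (g x) (g y), hg.dist_le_mul x y, hfg x]

/-- A discrete Grönwall bound for discounted partial sums. -/
theorem sum_range_pow_mul_le_of_succ_le {u : ℕ → ℝ} {K Δ γ : ℝ} (hu0 : u 0 = 0)
    (hu : ∀ n, u (n + 1) ≤ Δ + K * u n) (hK : 0 ≤ K) (hΔ : 0 ≤ Δ) (hγ0 : 0 ≤ γ) (hγ1 : γ < 1)
    (hγK : γ * K < 1) (N : ℕ) :
    ∑ n ∈ Finset.range N, γ ^ n * u n ≤ γ * Δ / ((1 - γ) * (1 - γ * K)) := by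
  have h₁ : 0 < 1 - γ := sub_pos.2 hγ1
  have h₂ : 0 < 1 - γ * K := sub_pos.2 hγK
  induction N with
  | zero => simpa using by positivity
  | succ N ih =>
    have hgeom : ∑ n ∈ Finset.range N, γ ^ n ≤ (1 - γ)⁻¹ := by
      rw [← tsum_geometric_of_lt_one hγ0 hγ1]
      exact (summable_geometric_of_lt_one hγ0 hγ1).sum_le_tsum _ fun n _ => pow_nonneg hγ0 n
    calc ∑ n ∈ Finset.range (N + 1), γ ^ n * u n
        = ∑ n ∈ Finset.range N, γ ^ (n + 1) * u (n + 1) := by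
          simp [Finset.sum_range_succ', hu0]
      _ ≤ ∑ n ∈ Finset.range N, γ ^ (n + 1) * (Δ + K * u n) := by
          gcongr with n
          exact hu n
      _ = γ * Δ * ∑ n ∈ Finset.range N, γ ^ n
            + γ * K * ∑ n ∈ Finset.range N, γ ^ n * u n := by
          rw [Finset.mul_sum, Finset.mul_sum, ← Finset.sum_add_distrib]
          exact Finset.sum_congr rfl fun n _ => by ring
      _ ≤ γ * Δ * (1 - γ)⁻¹ + γ * K * (γ * Δ / ((1 - γ) * (1 - γ * K))) := by gcongr
      _ = γ * Δ / ((1 - γ) * (1 - γ * K)) := by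
          field_simp
          ring

/-- **Discounted summation step in the proof of Theorem 4 (Value Error Bounds).**
Under the hypotheses of Theorem 3 (deterministic case), with discount factor
`γ ∈ [0, 1)` satisfying `γ * min K₁ K₂ < 1`, the discounted series of trajectory
distances converges and satisfies
`Σ_{n=0}^∞ γ^n * d (s n, ŝ n) ≤ γ * Δ / ((1 − γ) * (1 − γ * min K₁ K₂))`. -/
theorem discounted_transition_error_sum
    {S : Type*} [MetricSpace S] {A : Type*} [Nonempty A]
    (T That : S → A → S) (K₁ K₂ : ℝ≥0)
    (hT : ∀ a : A, LipschitzWith K₁ (fun s => T s a))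
    (hThat : ∀ a : A, LipschitzWith K₂ (fun s => That s a))
    (Δ : ℝ) (hΔ0 : 0 ≤ Δ)
    (hΔ : ∀ (s : S) (a : A), dist (T s a) (That s a) ≤ Δ)
    (γ : ℝ) (hγ0 : 0 ≤ γ) (hγ1 : γ < 1)
    (hγK : γ * (↑(min K₁ K₂) : ℝ) < 1)
    (acts : ℕ → A) (s₀ : S)
    (straj shat : ℕ → S)
    (hs0 : straj 0 = s₀) (hshat0 : shat 0 = s₀)
    (hstep : ∀ n, straj (n + 1) = T (straj n) (acts n))
    (hhatstep : ∀ n, shat (n + 1) = That (shat n) (acts n)) :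
    Summable (fun n : ℕ => γ ^ n * dist (straj n) (shat n)) ∧
    ∑' n : ℕ, γ ^ n * dist (straj n) (shat n) ≤
      γ * Δ / ((1 - γ) * (1 - γ * (↑(min K₁ K₂) : ℝ))) := by
  have hnonneg : ∀ n, 0 ≤ γ ^ n * dist (straj n) (shat n) := fun n => by positivity
  have hbound := sum_range_pow_mul_le_of_succ_le (u := fun n => dist (straj n) (shat n))
    (by simp [hs0, hshat0])
    (fun n => by
      simpa only [hstep, hhatstep] using dist_le_add_min_mul_dist (hT (acts n)) (hThat (acts n))
        (fun s => hΔ s (acts n)) (straj n) (shat n))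
    (min K₁ K₂).coe_nonneg hΔ0 hγ0 hγ1 hγK
  exact ⟨summable_of_sum_range_le hnonneg hbound, Real.tsum_le_of_sum_range_le hnonneg hbound⟩
end

section
/- Let (S, d) be a metric space, A a nonempty set, and let T, T̂ : S × A → S be two deterministic transition functions such that for every a ∈ A the map s ↦ T(s, a) is K₁-Lipschitz and the map s ↦ T̂(s, a) is K₂-Lipschitz. Let K̄ = min(K₁, K₂) with K̄ ≥ 0, and let Δ ≥ 0 satisfy d(T(s, a), T̂(s, a)) ≤ Δ for all s ∈ S and a ∈ A. Let R : S → ℝ be a reward function that is K_R-Lipschitz (|R(s₁) − R(s₂)| ≤ K_R·d(s₁, s₂) for all s₁, s₂ ∈ S) and bounded (there is M with |R(s)| ≤ M for all s ∈ S). Let γ ∈ [0, 1) with γ·K̄ < 1. Fix any sequence of actions a₀, a₁, … ∈ A and any initial state s₀ ∈ S, and define the trajectories s_{k+1} = T(s_k, a_k) and ŝ₀ = s₀, ŝ_{k+1} = T̂(ŝ_k, a_k), together with the discounted values V_T(s₀) = Σ_{n=0}^∞ γ^n R(s_n) and V_{T̂}(s₀) = Σ_{n=0}^∞ γ^n R(ŝ_n)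 (both series converge absolutely since R is bounded and γ < 1). Then |V_T(s₀) − V_{T̂}(s₀)| ≤ γ·K_R·Δ / ((1 − γ)(1 − γ·K̄)), uniformly over all initial states and all action sequences. -/
open scoped NNReal

/-- A perturbed contraction estimate: two trajectories whose one-step maps are uniformly `Δ`-close,
the first being `K`-Lipschitz, separate by at most an affine recursion. -/
lemma dist_trajectory_succ_le {S A : Type*} [PseudoMetricSpace S] {T That : S → A → S} {K : ℝ≥0}
    (hT : ∀ a, LipschitzWith K (fun s => T s a)) {Δ : ℝ}
    (hΔ : ∀ s a, dist (T s a) (That s a) ≤ Δ) {acts : ℕ → A} {x y : ℕ → S}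
    (hx : ∀ n, x (n + 1) = T (x n) (acts n)) (hy : ∀ n, y (n + 1) = That (y n) (acts n)) (n : ℕ) :
    dist (x (n + 1)) (y (n + 1)) ≤ Δ + K * dist (x n) (y n) := by
  rw [hx, hy]
  have hLip := (hT (acts n)).dist_le_mul (x n) (y n)
  linarith [dist_triangle (T (x n) (acts n)) (T (y n) (acts n)) (That (y n) (acts n)),
    hΔ (y n) (acts n)]

/-- A discounted Grönwall inequality for partial sums. -/
lemma sum_range_discounted_le {d : ℕ → ℝ} {Δ K γ : ℝ} (hd : ∀ n, 0 ≤ d n) (hd0 : d 0 = 0)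
    (hstep : ∀ n, d (n + 1) ≤ Δ + K * d n) (hΔ : 0 ≤ Δ) (hγ0 : 0 ≤ γ) (hγ1 : γ < 1)
    (hγK : γ * K < 1) (N : ℕ) :
    ∑ n ∈ Finset.range N, γ ^ n * d n ≤ γ * Δ / ((1 - γ) * (1 - γ * K)) := by
  have hgeom : ∑ n ∈ Finset.range N, γ ^ n ≤ (1 - γ)⁻¹ :=
    (tsum_geometric_of_lt_one hγ0 hγ1) ▸
      (summable_geometric_of_lt_one hγ0 hγ1).sum_le_tsum _ fun n _ => pow_nonneg hγ0 n
  have hrec : ∑ n ∈ Finset.range N, γ ^ n * d n ≤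
      γ * Δ * (1 - γ)⁻¹ + γ * K * ∑ n ∈ Finset.range N, γ ^ n * d n :=
    calc ∑ n ∈ Finset.range N, γ ^ n * d n
        ≤ ∑ n ∈ Finset.range (N + 1), γ ^ n * d n := by
          rw [Finset.sum_range_succ]
          exact le_add_of_nonneg_right (mul_nonneg (pow_nonneg hγ0 N) (hd N))
      _ = ∑ n ∈ Finset.range N, γ ^ (n + 1) * d (n + 1) := by
          simp [Finset.sum_range_succ', hd0]
      _ ≤ ∑ n ∈ Finset.range N, γ ^ (n + 1) * (Δ + K * d n) := by
          gcongr with n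
          exact hstep n
      _ = γ * Δ * ∑ n ∈ Finset.range N, γ ^ n
            + γ * K * ∑ n ∈ Finset.range N, γ ^ n * d n := by
          rw [Finset.mul_sum, Finset.mul_sum, ← Finset.sum_add_distrib]
          exact Finset.sum_congr rfl fun n _ => by ring
      _ ≤ _ := by gcongr
  rw [← div_div, le_div_iff₀ (by linarith), div_eq_mul_inv]
  linarith

/-- A bounded sequence is summable after geometric discounting. -/
lemma summable_discounted {r : ℕ → ℝ} {M γ : ℝ} (hr : ∀ n, |r n| ≤ M) (hγ0 : 0 ≤ γ)
    (hγ1 : γ < 1) : Summable fun n => γ ^ n * r n := by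
  refine Summable.of_norm_bounded ((summable_geometric_of_lt_one hγ0 hγ1).mul_right M) fun n => ?_
  rw [norm_mul, Real.norm_of_nonneg (pow_nonneg hγ0 n), Real.norm_eq_abs]
  exact mul_le_mul_of_nonneg_left (hr n) (pow_nonneg hγ0 n)

/-- **Theorem 4 (Value Error Bounds), deterministic case.**
Under the hypotheses of Theorem 3 (deterministic case), with a `K_R`-Lipschitz and
bounded reward `R` and discount factor `γ ∈ [0, 1)` satisfying `γ * min K₁ K₂ < 1`,
the discounted values `V_T (s₀) = Σ_n γ^n R (s_n)` and `V_T̂ (s₀) = Σ_n γ^n R (ŝ_n)`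
along the trajectories of `T` and `T̂` (both series converge) satisfy
`|V_T (s₀) − V_T̂ (s₀)| ≤ γ * K_R * Δ / ((1 − γ) * (1 − γ * min K₁ K₂))`, uniformly
over all initial states and all action sequences. -/
theorem value_error_bounds
    {S : Type*} [MetricSpace S] {A : Type*} [Nonempty A]
    (T That : S → A → S) (K₁ K₂ : ℝ≥0)
    (hT : ∀ a : A, LipschitzWith K₁ (fun s => T s a))
    (hThat : ∀ a : A, LipschitzWith K₂ (fun s => That s a))
    (Δ : ℝ) (hΔ0 : 0 ≤ Δ)
    (hΔ : ∀ (s : S) (a : A), dist (T s a) (That s a) ≤ Δ)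
    (R : S → ℝ) (KR : ℝ≥0) (hR : LipschitzWith KR R)
    (M : ℝ) (hM : ∀ s : S, |R s| ≤ M)
    (γ : ℝ) (hγ0 : 0 ≤ γ) (hγ1 : γ < 1)
    (hγK : γ * (↑(min K₁ K₂) : ℝ) < 1)
    (acts : ℕ → A) (s₀ : S)
    (straj shat : ℕ → S)
    (hs0 : straj 0 = s₀) (hshat0 : shat 0 = s₀)
    (hstep : ∀ n, straj (n + 1) = T (straj n) (acts n))
    (hhatstep : ∀ n, shat (n + 1) = That (shat n) (acts n)) :
    Summable (fun n : ℕ => γ ^ n * R (straj n)) ∧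
    Summable (fun n : ℕ => γ ^ n * R (shat n)) ∧
    |(∑' n : ℕ, γ ^ n * R (straj n)) - ∑' n : ℕ, γ ^ n * R (shat n)| ≤
      γ * (↑KR : ℝ) * Δ / ((1 - γ) * (1 - γ * (↑(min K₁ K₂) : ℝ))) := by
  have hx : Summable fun n => γ ^ n * R (straj n) :=
    summable_discounted (fun n => hM (straj n)) hγ0 hγ1
  have hy : Summable fun n => γ ^ n * R (shat n) :=
    summable_discounted (fun n => hM (shat n)) hγ0 hγ1
  have hrec : ∀ n, dist (straj (n + 1)) (shat (n + 1)) ≤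
      Δ + (↑(min K₁ K₂) : ℝ) * dist (straj n) (shat n) := by
    intro n
    rcases min_choice K₁ K₂ with h | h <;> rw [h]
    · exact dist_trajectory_succ_le hT hΔ hstep hhatstep n
    · rw [dist_comm (straj (n + 1)), dist_comm (straj n)]
      exact dist_trajectory_succ_le hThat (fun s a => dist_comm (T s a) _ ▸ hΔ s a)
        hhatstep hstep n
  have hsum := sum_range_discounted_le (d := fun n => dist (straj n) (shat n))
    (fun _ => dist_nonneg) (by simp [hs0, hshat0]) hrec hΔ0 hγ0 hγ1 hγK
  refine ⟨hx, hy, le_of_tendsto (hx.hasSum.sub hy.hasSum).tendsto_sum_nat.abs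
    (Filter.Eventually.of_forall fun N => ?_)⟩
  calc |∑ n ∈ Finset.range N, (γ ^ n * R (straj n) - γ ^ n * R (shat n))|
      ≤ ∑ n ∈ Finset.range N, |γ ^ n * R (straj n) - γ ^ n * R (shat n)| :=
        Finset.abs_sum_le_sum_abs _ _
    _ ≤ ∑ n ∈ Finset.range N, KR * (γ ^ n * dist (straj n) (shat n)) := by
        refine Finset.sum_le_sum fun n _ => ?_
        rw [← mul_sub, abs_mul, abs_of_nonneg (pow_nonneg hγ0 n), mul_left_comm]
        exact mul_le_mul_of_nonneg_left (hR.dist_le_mul _ _) (pow_nonneg hγ0 n)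
    _ ≤ KR * (γ * Δ / ((1 - γ) * (1 - γ * (↑(min K₁ K₂) : ℝ)))) := by
        rw [← Finset.mul_sum]
        exact mul_le_mul_of_nonneg_left (hsum N) KR.coe_nonneg
    _ = γ * KR * Δ / ((1 - γ) * (1 - γ * (↑(min K₁ K₂) : ℝ))) := by ring
end
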